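/- If A is a compact DG algebra over a field k, then the category of perfect DG A-modules Ho_per(A) is Ext-finite: for any perfect modules X, Y, the sum ∑_n dim Hom_{Ho(A)}(X, Y[n]) is finite. -/

import Mathlib

/- Framework: differential graded algebras (internal ℤ-grading), right DG modules,
DG bimodules, homotopy-theoretic notions (twisted modules, perfectness,
homological smoothness), cohomology and Hochschild homology. -/

open DirectSum TensorProduct

noncomputable section
set_option linter.unusedVariables false

/-- `(-1)^i` for `i : ℤ`, valued in `ℤ`. -/
def sgnz (i : ℤ) : ℤ := if Even i then 1 else -1

/-- `(-1)^i` for `i : ℤ`, valued in a field `k`. -/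
def sgnk (k : Type) [Field k] (i : ℤ) : k := if Even i then 1 else -1

/-- A differential graded algebra over a field `k`: a `k`-algebra with an internal
ℤ-grading and a square-zero degree `+1` differential satisfying the graded Leibniz rule. -/
structure DGAlgebra (k : Type) [Field k] : Type 1 where
  R : Type
  [ring : Ring R]
  [alg : Algebra k R]
  gr : ℤ → Submodule k R
  [dec : DirectSum.Decomposition gr]
  one_mem : (1 : R) ∈ gr 0
  mul_mem : ∀ {i j : ℤ} {x y : R}, x ∈ gr i → y ∈ gr j → x * y ∈ gr (i + j)
  d : R →ₗ[k] R
  d_deg : ∀ (i : ℤ), ∀ x ∈ gr i, d x ∈ gr (i + 1)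
  d_sq : ∀ x : R, d (d x) = 0
  leibniz : ∀ (i : ℤ), ∀ x ∈ gr i, ∀ y : R,
    d (x * y) = d x * y + sgnz i • (x * d y)

attribute [instance] DGAlgebra.ring DGAlgebra.alg DGAlgebra.dec

variable {k : Type} [Field k]

/-- A right DG module over a DG algebra `A`.  The right action of `x : A` on `m`
is written `act x m` (representing `m · x`). -/
structure DGMod (A : DGAlgebra k) : Type 1 where
  M : Type
  [acg : AddCommGroup M]
  [kmod : Module k M]
  gm : ℤ → Submodule k M
  [dec : DirectSum.Decomposition gm]
  act : A.R →ₗ[k] M →ₗ[k] M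
  act_one : ∀ m : M, act 1 m = m
  act_mul : ∀ (x y : A.R) (m : M), act (x * y) m = act y (act x m)
  act_deg : ∀ (i j : ℤ) (x : A.R) (m : M), x ∈ A.gr i → m ∈ gm j → act x m ∈ gm (j + i)
  D : M →ₗ[k] M
  D_deg : ∀ (j : ℤ), ∀ m ∈ gm j, D m ∈ gm (j + 1)
  D_sq : ∀ m : M, D (D m) = 0
  leibniz : ∀ (i j : ℤ) (x : A.R) (m : M), x ∈ A.gr i → m ∈ gm j →
    D (act x m) = act x (D m) + sgnz j • act (A.d x) m

attribute [instance] DGMod.acg DGMod.kmod DGMod.dec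

variable {A : DGAlgebra k}

/-- Morphisms of right DG modules (closed, degree 0). -/
structure DGHom (X Y : DGMod A) where
  f : X.M →ₗ[k] Y.M
  deg : ∀ (j : ℤ), ∀ m ∈ X.gm j, f m ∈ Y.gm j
  actc : ∀ (x : A.R) (m : X.M), f (X.act x m) = Y.act x (f m)
  comm : ∀ m : X.M, f (X.D m) = Y.D (f m)

/-- The identity morphism. -/
def DGHom.id (X : DGMod A) : DGHom X X :=
  ⟨LinearMap.id, fun _ _ h => h, fun _ _ => rfl, fun _ => rfl⟩

/-- Composition of morphisms of DG modules. -/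
def DGHom.comp {X Y Z : DGMod A} (G : DGHom Y Z) (F : DGHom X Y) : DGHom X Z :=
  ⟨G.f ∘ₗ F.f, fun j m h => G.deg j _ (F.deg j m h),
    fun x m => by simp [LinearMap.comp_apply, F.actc, G.actc],
    fun m => by simp [LinearMap.comp_apply, F.comm, G.comm]⟩

/-- The zero morphism. -/
def DGHom.zero (X Y : DGMod A) : DGHom X Y :=
  ⟨0, fun j _ _ => (Y.gm j).zero_mem, fun _ _ => by simp, fun _ => by simp⟩

/-- Chain homotopy between two morphisms of DG modules. -/
def Homotopic {X Y : DGMod A} (F G : DGHom X Y) : Prop :=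
  ∃ h : X.M →ₗ[k] Y.M,
    (∀ (j : ℤ), ∀ m ∈ X.gm j, h m ∈ Y.gm (j - 1)) ∧
    (∀ (x : A.R) (m : X.M), h (X.act x m) = Y.act x (h m)) ∧
    ∀ m : X.M, F.f m - G.f m = Y.D (h m) + h (X.D m)

/-- Cycles of degree `n` of a complex given by a grading and a differential. -/
def Zg {M : Type} [AddCommGroup M] [Module k M]
    (gm : ℤ → Submodule k M) (Dm : M →ₗ[k] M) (n : ℤ) : Submodule k M :=
  gm n ⊓ LinearMap.ker Dm

/-- Boundaries of degree `n`. -/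
def Bg {M : Type} [AddCommGroup M] [Module k M]
    (gm : ℤ → Submodule k M) (Dm : M →ₗ[k] M) (n : ℤ) : Submodule k M :=
  gm n ⊓ LinearMap.range Dm

/-- Degree `n` cohomology of a complex. -/
def Hg {M : Type} [AddCommGroup M] [Module k M]
    (gm : ℤ → Submodule k M) (Dm : M →ₗ[k] M) (n : ℤ) : Type :=
  ↥(Zg gm Dm n) ⧸ (Submodule.comap (Zg gm Dm n).subtype (Bg gm Dm n))

instance {M : Type} [AddCommGroup M] [Module k M]
    (gm : ℤ → Submodule k M) (Dm : M →ₗ[k] M) (n : ℤ) : AddCommGroup (Hg gm Dm n) := by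
  unfold Hg; infer_instance

instance {M : Type} [AddCommGroup M] [Module k M]
    (gm : ℤ → Submodule k M) (Dm : M →ₗ[k] M) (n : ℤ) : Module k (Hg gm Dm n) := by
  unfold Hg; infer_instance

/-- `f` induces an isomorphism on the homology of two complexes presented by
(families of) cycle and boundary submodules. -/
def InducesHIso {M₁ M₂ : Type} [AddCommGroup M₁] [Module k M₁] [AddCommGroup M₂] [Module k M₂]
    (Z₁ B₁ : ℤ → Submodule k M₁) (Z₂ B₂ : ℤ → Submodule k M₂) (f : M₁ →ₗ[k] M₂) : Prop :=
  (∀ n : ℤ, ∀ x ∈ Z₁ n, f x ∈ Z₂ n) ∧ (∀ n : ℤ, ∀ x ∈ B₁ n, f x ∈ B₂ n) ∧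
  ∀ n : ℤ, (∀ z ∈ Z₂ n, ∃ w ∈ Z₁ n, f w - z ∈ B₂ n) ∧
    (∀ w ∈ Z₁ n, f w ∈ B₂ n → w ∈ B₁ n)

/-- Quasi-isomorphism of complexes, in elementary terms. -/
def QIsoData {M₁ M₂ : Type} [AddCommGroup M₁] [Module k M₁] [AddCommGroup M₂] [Module k M₂]
    (gm₁ : ℤ → Submodule k M₁) (D₁ : M₁ →ₗ[k] M₁)
    (gm₂ : ℤ → Submodule k M₂) (D₂ : M₂ →ₗ[k] M₂) (f : M₁ →ₗ[k] M₂) : Prop :=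
  InducesHIso (Zg gm₁ D₁) (Bg gm₁ D₁) (Zg gm₂ D₂) (Bg gm₂ D₂) f

/-- A morphism of DG modules is a quasi-isomorphism if it induces isomorphisms on
all cohomology groups. -/
def IsQuasiIso {X Y : DGMod A} (F : DGHom X Y) : Prop :=
  QIsoData X.gm X.D Y.gm Y.D F.f

/-- A DG module is acyclic if all its cohomology vanishes. -/
def AcyclicM (X : DGMod A) : Prop := ∀ n : ℤ, Zg X.gm X.D n ≤ Bg X.gm X.D n

/-- The `A`-submodule of a right DG module generated by a set. -/
def rSpan (X : DGMod A) (S : Set X.M) : Submodule k X.M :=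
  sInf {p : Submodule k X.M | S ⊆ ↑p ∧ ∀ (x : A.R) (m : X.M), m ∈ p → X.act x m ∈ p}

/-- Twisted modules: finitely generated semi-free right DG `A`-modules, i.e.
modules with a finite homogeneous basis `e` such that `D (e j)` lies in the
`A`-span of the previous basis elements ("strictly upper triangular" twisting). -/
def IsTwisted (T : DGMod A) : Prop :=
  ∃ (s : ℕ) (r : Fin s → ℤ) (e : Fin s → T.M),
    (∀ j, e j ∈ T.gm (-(r j))) ∧
    (∀ j, T.D (e j) ∈ rSpan T (e '' {i | i < j})) ∧
    Function.Bijective (fun v : Fin s → A.R => ∑ j, T.act (v j) (e j))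

/-- `P` is a homotopy direct summand of `T`. -/
def IsHoSummand (P T : DGMod A) : Prop :=
  ∃ (ι : DGHom P T) (ρ : DGHom T P), Homotopic (ρ.comp ι) (DGHom.id P)

/-- A perfect DG module: one admitting a resolution by a homotopy direct summand
of a twisted module. -/
def IsPerfect (N : DGMod A) : Prop :=
  ∃ T P : DGMod A, IsTwisted T ∧ IsHoSummand P T ∧ ∃ F : DGHom P N, IsQuasiIso F

/-- Homotopically projective (K-projective) DG modules. -/
def IsHoProjM (P : DGMod A) : Prop :=
  ∀ N : DGMod A, AcyclicM N → ∀ F : DGHom P N, Homotopic F (DGHom.zero P N)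

/-- Compactness of a DG algebra: the total cohomology is finite dimensional. -/
def IsCompactAlg (A : DGAlgebra k) : Prop :=
  (∀ n : ℤ, FiniteDimensional k (Hg A.gr A.d n)) ∧
    {n : ℤ | ¬ Subsingleton (Hg A.gr A.d n)}.Finite
/-- The grading operator on a graded module scaling the degree `j` component by `c j`. -/
def gop {M : Type} [AddCommGroup M] [Module k M]
    (gm : ℤ → Submodule k M) [DirectSum.Decomposition gm] (c : ℤ → k) : M →ₗ[k] M :=
  (DirectSum.toModule k ℤ M (fun j => c j • (gm j).subtype)) ∘ₗ
    (DirectSum.decomposeLinearEquiv gm).toLinearMap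

/-- A DG bimodule over `A` (equivalently, a right DG module over `Aᵉ = Aᵒᵖ ⊗ A`). -/
structure DGBimod (A : DGAlgebra k) : Type 1 where
  M : Type
  [acg : AddCommGroup M]
  [kmod : Module k M]
  gm : ℤ → Submodule k M
  [dec : DirectSum.Decomposition gm]
  actL : A.R →ₗ[k] M →ₗ[k] M
  actR : A.R →ₗ[k] M →ₗ[k] M
  actL_one : ∀ m : M, actL 1 m = m
  actR_one : ∀ m : M, actR 1 m = m
  actL_mul : ∀ (x y : A.R) (m : M), actL (x * y) m = actL x (actL y m)
  actR_mul : ∀ (x y : A.R) (m : M), actR (x * y) m = actR y (actR x m)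
  actLR : ∀ (x y : A.R) (m : M), actL x (actR y m) = actR y (actL x m)
  actL_deg : ∀ (i j : ℤ) (x : A.R) (m : M), x ∈ A.gr i → m ∈ gm j → actL x m ∈ gm (i + j)
  actR_deg : ∀ (i j : ℤ) (x : A.R) (m : M), x ∈ A.gr i → m ∈ gm j → actR x m ∈ gm (j + i)
  D : M →ₗ[k] M
  D_deg : ∀ (j : ℤ), ∀ m ∈ gm j, D m ∈ gm (j + 1)
  D_sq : ∀ m : M, D (D m) = 0
  leibnizL : ∀ (i j : ℤ) (x : A.R) (m : M), x ∈ A.gr i → m ∈ gm j →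
    D (actL x m) = actL (A.d x) m + sgnz i • actL x (D m)
  leibnizR : ∀ (i j : ℤ) (x : A.R) (m : M), x ∈ A.gr i → m ∈ gm j →
    D (actR x m) = actR x (D m) + sgnz j • actR (A.d x) m

attribute [instance] DGBimod.acg DGBimod.kmod DGBimod.dec

/-- Morphisms of DG bimodules (closed, degree 0). -/
structure BimodHom {A : DGAlgebra k} (X Y : DGBimod A) where
  f : X.M →ₗ[k] Y.M
  deg : ∀ (j : ℤ), ∀ m ∈ X.gm j, f m ∈ Y.gm j
  actLc : ∀ (x : A.R) (m : X.M), f (X.actL x m) = Y.actL x (f m)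
  actRc : ∀ (x : A.R) (m : X.M), f (X.actR x m) = Y.actR x (f m)
  comm : ∀ m : X.M, f (X.D m) = Y.D (f m)

def BimodHom.id (X : DGBimod A) : BimodHom X X :=
  ⟨LinearMap.id, fun _ _ h => h, fun _ _ => rfl, fun _ _ => rfl, fun _ => rfl⟩

def BimodHom.comp {X Y Z : DGBimod A} (G : BimodHom Y Z) (F : BimodHom X Y) : BimodHom X Z :=
  ⟨G.f ∘ₗ F.f, fun j m h => G.deg j _ (F.deg j m h),
    fun x m => by simp [LinearMap.comp_apply, F.actLc, G.actLc],
    fun x m => by simp [LinearMap.comp_apply, F.actRc, G.actRc],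
    fun m => by simp [LinearMap.comp_apply, F.comm, G.comm]⟩

def BimodHom.zero (X Y : DGBimod A) : BimodHom X Y :=
  ⟨0, fun j _ _ => (Y.gm j).zero_mem, fun _ _ => by simp, fun _ _ => by simp, fun _ => by simp⟩

/-- Chain homotopy between morphisms of DG bimodules (with the Koszul sign for the
left action). -/
def BimodHomotopic {X Y : DGBimod A} (F G : BimodHom X Y) : Prop :=
  ∃ h : X.M →ₗ[k] Y.M,
    (∀ (j : ℤ), ∀ m ∈ X.gm j, h m ∈ Y.gm (j - 1)) ∧
    (∀ (i : ℤ) (x : A.R), x ∈ A.gr i → ∀ m : X.M, h (X.actL x m) = sgnz i • Y.actL x (h m)) ∧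
    (∀ (x : A.R) (m : X.M), h (X.actR x m) = Y.actR x (h m)) ∧
    ∀ m : X.M, F.f m - G.f m = Y.D (h m) + h (X.D m)

def AcyclicB (X : DGBimod A) : Prop := ∀ n : ℤ, Zg X.gm X.D n ≤ Bg X.gm X.D n

def IsHoProjB (P : DGBimod A) : Prop :=
  ∀ N : DGBimod A, AcyclicB N → ∀ F : BimodHom P N, BimodHomotopic F (BimodHom.zero P N)

/-- Auxiliary: the action of a homogeneous element of degree `i` in the first tensor
factor of `Aᵉ` on a bimodule, with its Koszul sign. -/
def biactAux (N : DGBimod A) (i : ℤ) : ↥(A.gr i) →ₗ[k] A.R →ₗ[k] N.M →ₗ[k] N.M where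
  toFun x :=
    { toFun := fun y => (N.actL ↑x) ∘ₗ (N.actR y) ∘ₗ (gop N.gm fun j => sgnk k (i * j))
      map_add' := by intro y z; ext m; simp
      map_smul' := by intro c y; ext m; simp }
  map_add' := by intro x z; ext y m; simp [Submodule.coe_add]
  map_smul' := by intro c x; ext y m; simp

/-- The right action of `Aᵉ = Aᵒᵖ ⊗ A` (as a `k`-module, `A.R ⊗[k] A.R`) on a DG
bimodule, with Koszul signs. -/
def biact (N : DGBimod A) : (A.R ⊗[k] A.R) →ₗ[k] N.M →ₗ[k] N.M :=
  TensorProduct.lift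
    ((DirectSum.toModule k ℤ _ (fun i => biactAux N i)) ∘ₗ
      (DirectSum.decomposeLinearEquiv A.gr).toLinearMap)

/-- The sub-bimodule generated by a set. -/
def biSpan (N : DGBimod A) (S : Set N.M) : Submodule k N.M :=
  sInf {p : Submodule k N.M | S ⊆ ↑p ∧ (∀ (x : A.R) (m : N.M), m ∈ p → N.actL x m ∈ p) ∧
    ∀ (x : A.R) (m : N.M), m ∈ p → N.actR x m ∈ p}

/-- Twisted DG bimodules: finitely generated semi-free DG `Aᵉ`-modules. -/
def IsTwistedB (T : DGBimod A) : Prop :=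
  ∃ (s : ℕ) (r : Fin s → ℤ) (e : Fin s → T.M),
    (∀ j, e j ∈ T.gm (-(r j))) ∧
    (∀ j, T.D (e j) ∈ biSpan T (e '' {i | i < j})) ∧
    Function.Bijective (fun v : Fin s → A.R ⊗[k] A.R => ∑ j, biact T (v j) (e j))

def IsHoSummandB (P T : DGBimod A) : Prop :=
  ∃ (ι : BimodHom P T) (ρ : BimodHom T P), BimodHomotopic (ρ.comp ι) (BimodHom.id P)

def IsPerfectB (N : DGBimod A) : Prop :=
  ∃ T P : DGBimod A, IsTwistedB T ∧ IsHoSummandB P T ∧ ∃ F : BimodHom P N, QIsoData P.gm P.D N.gm N.D F.f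

/-- The diagonal bimodule: `A` as a DG bimodule over itself. -/
def diagBimod (A : DGAlgebra k) : DGBimod A where
  M := A.R
  gm := A.gr
  actL := LinearMap.mul k A.R
  actR := (LinearMap.mul k A.R).flip
  actL_one := fun m => one_mul m
  actR_one := fun m => mul_one m
  actL_mul := fun x y m => mul_assoc x y m
  actR_mul := fun x y m => (mul_assoc m x y).symm
  actLR := fun x y m => (mul_assoc x m y).symm
  actL_deg := fun i j x m hx hm => A.mul_mem hx hm
  actR_deg := fun i j x m hx hm => A.mul_mem hm hx
  D := A.d
  D_deg := A.d_deg
  D_sq := A.d_sq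
  leibnizL := fun i j x m hx _ => A.leibniz i x hx m
  leibnizR := fun i j x m _ hm => A.leibniz j m hm x

/-- `A` is homologically smooth if the diagonal bimodule is perfect over `Aᵉ`. -/
def IsSmooth (A : DGAlgebra k) : Prop := IsPerfectB (diagBimod A)

/-- The graded commutator subspace `[A, P] ⊆ P` of a DG bimodule. -/
def commSub (P : DGBimod A) : Submodule k P.M :=
  Submodule.span k {z : P.M | ∃ (i j : ℤ) (x : A.R) (m : P.M), x ∈ A.gr i ∧ m ∈ P.gm j ∧
    z = P.actL x m - sgnz (i * j) • P.actR x m}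

/-- Degree-`n` cycles of the complex `P/[A,P]` (computing `P ⊗_{Aᵉ} A`), described by
representatives in `P`. -/
def HHZ (P : DGBimod A) (n : ℤ) : Submodule k P.M :=
  P.gm n ⊓ (commSub P).comap P.D

/-- Degree-`n` boundaries of the complex `P/[A,P]`, described by representatives. -/
def HHB (P : DGBimod A) (n : ℤ) : Submodule k P.M :=
  P.gm n ⊓ (commSub P ⊔ LinearMap.range P.D)

/-- The `n`-th Hochschild homology group `HH_n(A) = H^n(P ⊗_{Aᵉ} A)` computed from a
bimodule resolution `P` of the diagonal. -/
def HHspace (P : DGBimod A) (n : ℤ) : Type :=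
  ↥(HHZ P n) ⧸ (Submodule.comap (HHZ P n).subtype (HHB P n ⊓ HHZ P n))

instance (P : DGBimod A) (n : ℤ) : AddCommGroup (HHspace P n) := by
  unfold HHspace; infer_instance

instance (P : DGBimod A) (n : ℤ) : Module k (HHspace P n) := by
  unfold HHspace; infer_instance

/-- `F : P → A` is an h-projective bimodule resolution of the diagonal bimodule. -/
def IsDiagResolution {A : DGAlgebra k} (P : DGBimod A) (F : BimodHom P (diagBimod A)) : Prop :=
  IsHoProjB P ∧ QIsoData P.gm P.D (diagBimod A).gm (diagBimod A).D F.f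
/-! ### Hom complexes and Ext spaces -/

/-- The degree-`n` part of the Hom complex of two right DG `A`-modules:
`A`-linear maps shifting degrees by `n`. -/
def homGrade (X Y : DGMod A) (n : ℤ) : Submodule k (X.M →ₗ[k] Y.M) where
  carrier := {f | (∀ (j : ℤ), ∀ m ∈ X.gm j, f m ∈ Y.gm (j + n)) ∧
    ∀ (x : A.R) (m : X.M), f (X.act x m) = Y.act x (f m)}
  add_mem' := by
    rintro f g ⟨hf1, hf2⟩ ⟨hg1, hg2⟩
    refine ⟨fun j m hm => ?_, fun x m => ?_⟩
    · exact (Y.gm (j + n)).add_mem (hf1 j m hm) (hg1 j m hm)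
    · simp [hf2, hg2]
  zero_mem' := by
    refine ⟨fun j m hm => (Y.gm (j + n)).zero_mem, fun x m => by simp⟩
  smul_mem' := by
    rintro c f ⟨hf1, hf2⟩
    refine ⟨fun j m hm => (Y.gm (j + n)).smul_mem c (hf1 j m hm), fun x m => ?_⟩
    simp [hf2]

theorem mem_homGrade {X Y : DGMod A} {n : ℤ} {f : X.M →ₗ[k] Y.M} :
    f ∈ homGrade X Y n ↔ ((∀ (j : ℤ), ∀ m ∈ X.gm j, f m ∈ Y.gm (j + n)) ∧
      ∀ (x : A.R) (m : X.M), f (X.act x m) = Y.act x (f m)) := Iff.rfl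

/-- The differential of the Hom complex in degree `n`:
`f ↦ D_Y ∘ f - (-1)^n f ∘ D_X`. -/
def homDop (X Y : DGMod A) (n : ℤ) : (X.M →ₗ[k] Y.M) →ₗ[k] (X.M →ₗ[k] Y.M) :=
  (LinearMap.llcomp k X.M Y.M Y.M) Y.D - sgnz n • (LinearMap.llcomp k X.M X.M Y.M).flip X.D

/-- Closed degree-`n` `A`-linear maps. -/
def ZHomS (X Y : DGMod A) (n : ℤ) : Submodule k (X.M →ₗ[k] Y.M) :=
  homGrade X Y n ⊓ LinearMap.ker (homDop X Y n)

/-- Degree-`n` boundaries of the Hom complex. -/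
def BHomS (X Y : DGMod A) (n : ℤ) : Submodule k (X.M →ₗ[k] Y.M) :=
  Submodule.map (homDop X Y (n - 1)) (homGrade X Y (n - 1))

/-- `Hom_{Ho(A)}(X, Y[n])`: the `n`-th cohomology of the Hom complex.  For
homotopically projective `X` this computes `Hom_{D(A)}(X, Y[n])`. -/
def ExtSpace (X Y : DGMod A) (n : ℤ) : Type :=
  ↥(ZHomS X Y n) ⧸ (Submodule.comap (ZHomS X Y n).subtype (BHomS X Y n ⊓ ZHomS X Y n))

instance (X Y : DGMod A) (n : ℤ) : AddCommGroup (ExtSpace X Y n) := by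
  unfold ExtSpace; infer_instance

instance (X Y : DGMod A) (n : ℤ) : Module k (ExtSpace X Y n) := by
  unfold ExtSpace; infer_instance

/-! ### Shifts, cones, isomorphisms in the homotopy category -/

/-- `X'` realizes the shift `X[t]` (so `X'^n = X^{n+t}`). -/
def IsShiftOf (X X' : DGMod A) (t : ℤ) : Prop :=
  ∃ g : X.M ≃ₗ[k] X'.M,
    (∀ n : ℤ, ∀ m ∈ X.gm (n + t), g m ∈ X'.gm n) ∧
    (∀ (x : A.R) (m : X.M), g (X.act x m) = X'.act x (g m)) ∧
    ∀ m : X.M, g (X.D m) = sgnz t • X'.D (g m)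

/-- `C` realizes the cone of the closed morphism `F : X → Y` with canonical
inclusion `j : Y → C`. -/
def IsConeOf {X Y : DGMod A} (F : DGHom X Y) (C : DGMod A) (j : DGHom Y C) : Prop :=
  ∃ (p : C.M →ₗ[k] X.M) (s : X.M →ₗ[k] C.M) (q : C.M →ₗ[k] Y.M),
    (∀ n : ℤ, ∀ c ∈ C.gm n, p c ∈ X.gm (n + 1)) ∧
    (∀ n : ℤ, ∀ m ∈ X.gm (n + 1), s m ∈ C.gm n) ∧
    (∀ n : ℤ, ∀ c ∈ C.gm n, q c ∈ Y.gm n) ∧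
    (∀ (x : A.R) (c : C.M), p (C.act x c) = X.act x (p c)) ∧
    (∀ (x : A.R) (m : X.M), s (X.act x m) = C.act x (s m)) ∧
    (∀ (x : A.R) (c : C.M), q (C.act x c) = Y.act x (q c)) ∧
    (∀ y : Y.M, q (j.f y) = y) ∧ (∀ m : X.M, p (s m) = m) ∧
    (∀ m : X.M, q (s m) = 0) ∧ (∀ y : Y.M, p (j.f y) = 0) ∧
    (∀ c : C.M, j.f (q c) + s (p c) = c) ∧
    ∀ m : X.M, C.D (s m) = j.f (F.f m) - s (X.D m)

/-- Isomorphism in the homotopy category of DG modules. -/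
def HoIso (X Y : DGMod A) : Prop :=
  ∃ (F : DGHom X Y) (G : DGHom Y X),
    Homotopic (G.comp F) (DGHom.id X) ∧ Homotopic (F.comp G) (DGHom.id Y)
/-! ### Left DG modules (right modules over `Aᵒᵖ`) and duality complexes -/

/-- A left DG module over `A` (equivalently, a right DG module over `Aᵒᵖ`). -/
structure DGModL (A : DGAlgebra k) : Type 1 where
  M : Type
  [acg : AddCommGroup M]
  [kmod : Module k M]
  gm : ℤ → Submodule k M
  [dec : DirectSum.Decomposition gm]
  actL : A.R →ₗ[k] M →ₗ[k] M
  actL_one : ∀ m : M, actL 1 m = m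
  actL_mul : ∀ (x y : A.R) (m : M), actL (x * y) m = actL x (actL y m)
  actL_deg : ∀ (i j : ℤ) (x : A.R) (m : M), x ∈ A.gr i → m ∈ gm j → actL x m ∈ gm (i + j)
  D : M →ₗ[k] M
  D_deg : ∀ (j : ℤ), ∀ m ∈ gm j, D m ∈ gm (j + 1)
  D_sq : ∀ m : M, D (D m) = 0
  leibnizL : ∀ (i j : ℤ) (x : A.R) (m : M), x ∈ A.gr i → m ∈ gm j →
    D (actL x m) = actL (A.d x) m + sgnz i • actL x (D m)

attribute [instance] DGModL.acg DGModL.kmod DGModL.dec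

/-- Morphisms of left DG modules. -/
structure DGHomL (X Y : DGModL A) where
  f : X.M →ₗ[k] Y.M
  deg : ∀ (j : ℤ), ∀ m ∈ X.gm j, f m ∈ Y.gm j
  actc : ∀ (x : A.R) (m : X.M), f (X.actL x m) = Y.actL x (f m)
  comm : ∀ m : X.M, f (X.D m) = Y.D (f m)

def DGHomL.id (X : DGModL A) : DGHomL X X :=
  ⟨LinearMap.id, fun _ _ h => h, fun _ _ => rfl, fun _ => rfl⟩

def DGHomL.comp {X Y Z : DGModL A} (G : DGHomL Y Z) (F : DGHomL X Y) : DGHomL X Z :=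
  ⟨G.f ∘ₗ F.f, fun j m h => G.deg j _ (F.deg j m h),
    fun x m => by simp [LinearMap.comp_apply, F.actc, G.actc],
    fun m => by simp [LinearMap.comp_apply, F.comm, G.comm]⟩

def HomotopicL {X Y : DGModL A} (F G : DGHomL X Y) : Prop :=
  ∃ h : X.M →ₗ[k] Y.M,
    (∀ (j : ℤ), ∀ m ∈ X.gm j, h m ∈ Y.gm (j - 1)) ∧
    (∀ (i : ℤ) (x : A.R), x ∈ A.gr i → ∀ m : X.M, h (X.actL x m) = sgnz i • Y.actL x (h m)) ∧
    ∀ m : X.M, F.f m - G.f m = Y.D (h m) + h (X.D m)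

def lSpan (X : DGModL A) (S : Set X.M) : Submodule k X.M :=
  sInf {p : Submodule k X.M | S ⊆ ↑p ∧ ∀ (x : A.R) (m : X.M), m ∈ p → X.actL x m ∈ p}

def IsTwistedL (T : DGModL A) : Prop :=
  ∃ (s : ℕ) (r : Fin s → ℤ) (e : Fin s → T.M),
    (∀ j, e j ∈ T.gm (-(r j))) ∧
    (∀ j, T.D (e j) ∈ lSpan T (e '' {i | i < j})) ∧
    Function.Bijective (fun v : Fin s → A.R => ∑ j, T.actL (v j) (e j))

def IsHoSummandL (P T : DGModL A) : Prop :=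
  ∃ (ι : DGHomL P T) (ρ : DGHomL T P), HomotopicL (ρ.comp ι) (DGHomL.id P)

def IsPerfectL (N : DGModL A) : Prop :=
  ∃ T P : DGModL A, IsTwistedL T ∧ IsHoSummandL P T ∧
    ∃ F : DGHomL P N, QIsoData P.gm P.D N.gm N.D F.f

/-- The degree-`n` part of the complex `Hom_A(X, A)` of right `A`-module maps into `A`. -/
def rHomGrade (X : DGMod A) (n : ℤ) : Submodule k (X.M →ₗ[k] A.R) where
  carrier := {g | (∀ (j : ℤ), ∀ m ∈ X.gm j, g m ∈ A.gr (j + n)) ∧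
    ∀ (x : A.R) (m : X.M), g (X.act x m) = g m * x}
  add_mem' := by
    rintro f g ⟨hf1, hf2⟩ ⟨hg1, hg2⟩
    exact ⟨fun j m hm => (A.gr (j + n)).add_mem (hf1 j m hm) (hg1 j m hm),
      fun x m => by simp [hf2, hg2, add_mul]⟩
  zero_mem' := ⟨fun j m hm => (A.gr (j + n)).zero_mem, fun x m => by simp⟩
  smul_mem' := by
    rintro c f ⟨hf1, hf2⟩
    exact ⟨fun j m hm => (A.gr (j + n)).smul_mem c (hf1 j m hm),
      fun x m => by simp [hf2, Algebra.smul_mul_assoc]⟩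

/-- `V` realizes the dual complex `X^∨ = RHom_A(X, A)` of a (homotopically projective)
right DG module `X`, as a left DG module. -/
def IsRightDualOf (X : DGMod A) (V : DGModL A) : Prop :=
  ∃ Φ : V.M →ₗ[k] (X.M →ₗ[k] A.R),
    Function.Injective Φ ∧
    (∀ n : ℤ, Submodule.map Φ (V.gm n) = rHomGrade X n) ∧
    (∀ (n : ℤ), ∀ v ∈ V.gm n, Φ (V.D v) = A.d ∘ₗ Φ v - sgnz n • (Φ v ∘ₗ X.D)) ∧
    ∀ (x : A.R) (v : V.M), Φ (V.actL x v) = LinearMap.mul k A.R x ∘ₗ Φ v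

/-- The degree-`n` part of the complex `Hom_{Aᵒᵖ}(V, A)` of left `A`-module maps into `A`
(with Koszul signs for moving a degree-`n` map past a left action). -/
def lHomGrade (V : DGModL A) (n : ℤ) : Submodule k (V.M →ₗ[k] A.R) where
  carrier := {g | (∀ (j : ℤ), ∀ v ∈ V.gm j, g v ∈ A.gr (j + n)) ∧
    ∀ (i : ℤ) (x : A.R), x ∈ A.gr i → ∀ v : V.M, g (V.actL x v) = sgnz (i * n) • (x * g v)}
  add_mem' := by
    rintro f g ⟨hf1, hf2⟩ ⟨hg1, hg2⟩
    exact ⟨fun j v hv => (A.gr (j + n)).add_mem (hf1 j v hv) (hg1 j v hv),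
      fun i x hx v => by simp [hf2 i x hx, hg2 i x hx, mul_add, smul_add]⟩
  zero_mem' := ⟨fun j v hv => (A.gr (j + n)).zero_mem, fun i x hx v => by simp⟩
  smul_mem' := by
    rintro c f ⟨hf1, hf2⟩
    refine ⟨fun j v hv => (A.gr (j + n)).smul_mem c (hf1 j v hv), fun i x hx v => ?_⟩
    simp only [LinearMap.smul_apply, hf2 i x hx, Algebra.mul_smul_comm]
    rw [smul_comm]

/-- `W` realizes the bidual complex `Hom_{Aᵒᵖ}(V, A)` of a left DG module `V`,
as a right DG module. -/
def IsLeftDualOf (V : DGModL A) (W : DGMod A) : Prop :=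
  ∃ Ψ : W.M →ₗ[k] (V.M →ₗ[k] A.R),
    Function.Injective Ψ ∧
    (∀ n : ℤ, Submodule.map Ψ (W.gm n) = lHomGrade V n) ∧
    (∀ (n : ℤ), ∀ w ∈ W.gm n, Ψ (W.D w) = A.d ∘ₗ Ψ w - sgnz n • (Ψ w ∘ₗ V.D)) ∧
    ∀ (x : A.R) (w : W.M), Ψ (W.act x w) = (LinearMap.mul k A.R).flip x ∘ₗ Ψ w

/-- The degree-`j` part of the graded `k`-linear dual of a graded module:
functionals vanishing on all components of degree `≠ -j`. -/
def dualGrade {M : Type} [AddCommGroup M] [Module k M]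
    (gm : ℤ → Submodule k M) (j : ℤ) : Submodule k (M →ₗ[k] k) where
  carrier := {ν | ∀ l : ℤ, l ≠ -j → ∀ m ∈ gm l, ν m = 0}
  add_mem' := by
    intro f g hf hg l hl m hm
    simp [hf l hl m hm, hg l hl m hm]
  zero_mem' := by intro l hl m hm; simp
  smul_mem' := by
    intro c f hf l hl m hm
    simp [hf l hl m hm]

/-- `W` realizes the graded `k`-linear dual of a left DG module `V`, as a right DG
module (the Nakayama construction `V ↦ V^*`). -/
def IsGradedKDual (V : DGModL A) (W : DGMod A) : Prop :=
  ∃ Ψ : W.M →ₗ[k] (V.M →ₗ[k] k),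
    (∀ (n : ℤ), ∀ w ∈ W.gm n, Ψ w ∈ dualGrade V.gm n) ∧
    (∀ n : ℤ, Function.Bijective
      (fun w : ↥(W.gm n) => (Ψ ↑w) ∘ₗ (V.gm (-n)).subtype)) ∧
    (∀ (n : ℤ), ∀ w ∈ W.gm n, ∀ v : V.M, Ψ (W.D w) v = -(sgnz n) • Ψ w (V.D v)) ∧
    ∀ (i : ℤ) (x : A.R), x ∈ A.gr i → ∀ (n : ℤ), ∀ w ∈ W.gm n, ∀ v : V.M,
      Ψ (W.act x w) v = sgnz (i * n) • Ψ w (V.actL x v)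

/-- `W` realizes the Nakayama functor value `S_A(X) = (X^∨)^*`. -/
def IsNakayamaOf (X : DGMod A) (W : DGMod A) : Prop :=
  ∃ V : DGModL A, IsRightDualOf X V ∧ IsGradedKDual V W
/-! ### Graded tensor products, dual complexes, and bimodule Hom complexes -/

/-- The degree-`n` part of the tensor product of two graded modules. -/
def tenGrade {M₁ M₂ : Type} [AddCommGroup M₁] [Module k M₁] [AddCommGroup M₂] [Module k M₂]
    (gm₁ : ℤ → Submodule k M₁) (gm₂ : ℤ → Submodule k M₂) (n : ℤ) :
    Submodule k (M₁ ⊗[k] M₂) :=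
  Submodule.span k {t : M₁ ⊗[k] M₂ | ∃ (i j : ℤ) (x : M₁) (y : M₂),
    x ∈ gm₁ i ∧ y ∈ gm₂ j ∧ i + j = n ∧ t = x ⊗ₜ y}

/-- The differential `D₁ ⊗ 1 + σ₁ ⊗ D₂` on a tensor product of complexes, where `σ₁`
is the sign operator of the first factor. -/
def tenD {M₁ M₂ : Type} [AddCommGroup M₁] [Module k M₁] [AddCommGroup M₂] [Module k M₂]
    (D₁ : M₁ →ₗ[k] M₁) (s₁ : M₁ →ₗ[k] M₁) (D₂ : M₂ →ₗ[k] M₂) :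
    (M₁ ⊗[k] M₂) →ₗ[k] (M₁ ⊗[k] M₂) :=
  TensorProduct.map D₁ LinearMap.id + TensorProduct.map s₁ D₂

/-- Cycles of a quotient complex `M/K`, described by representatives in `M`. -/
def ZgK {M : Type} [AddCommGroup M] [Module k M]
    (gm : ℤ → Submodule k M) (Dm : M →ₗ[k] M) (K : Submodule k M) (n : ℤ) :
    Submodule k M :=
  gm n ⊓ K.comap Dm

/-- Boundaries of a quotient complex `M/K`, described by representatives in `M`. -/
def BgK {M : Type} [AddCommGroup M] [Module k M]
    (gm : ℤ → Submodule k M) (Dm : M →ₗ[k] M) (K : Submodule k M) (n : ℤ) :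
    Submodule k M :=
  gm n ⊓ (K ⊔ LinearMap.range Dm)

/-- The differential of the graded dual of a complex. -/
def dualD {M : Type} [AddCommGroup M] [Module k M]
    (gm : ℤ → Submodule k M) [DirectSum.Decomposition gm] (Dm : M →ₗ[k] M) :
    (M →ₗ[k] k) →ₗ[k] (M →ₗ[k] k) :=
  -((LinearMap.llcomp k M M k).flip (Dm ∘ₗ gop gm fun j => sgnk k (j + 1)))

/-- The left `A`-action on the dual `M^*` of a right DG `A`-module `M`. -/
def dualActL (M : DGMod A) (x : A.R) : (M.M →ₗ[k] k) →ₗ[k] (M.M →ₗ[k] k) :=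
  (LinearMap.llcomp k M.M M.M k).flip (M.act x)

/-- The relations submodule defining `X ⊗_A V` inside `X ⊗_k V` for a right module `X`
and a bimodule `V`. -/
def tenRelMB (X : DGMod A) (V : DGBimod A) : Submodule k (X.M ⊗[k] V.M) :=
  Submodule.span k {t : X.M ⊗[k] V.M | ∃ (a : A.R) (x : X.M) (v : V.M),
    t = (X.act a x) ⊗ₜ v - x ⊗ₜ (V.actL a v)}

/-- The relations submodule defining `U ⊗_A V` inside `U ⊗_k V` for two bimodules. -/
def tenRelBB (U V : DGBimod A) : Submodule k (U.M ⊗[k] V.M) :=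
  Submodule.span k {t : U.M ⊗[k] V.M | ∃ (a : A.R) (u : U.M) (v : V.M),
    t = (U.actR a u) ⊗ₜ v - u ⊗ₜ (V.actL a v)}

/-- `V` realizes the dual bimodule `A^* = Hom_k(A, k)` (with its canonical DG
`A`-bimodule structure induced from the diagonal bimodule `A`). -/
def IsDualDiagOf {A : DGAlgebra k} (V : DGBimod A) : Prop :=
  ∃ Ψ : V.M →ₗ[k] (A.R →ₗ[k] k),
    (∀ (n : ℤ), ∀ v ∈ V.gm n, Ψ v ∈ dualGrade A.gr n) ∧
    (∀ n : ℤ, Function.Bijective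
      (fun v : ↥(V.gm n) => (Ψ ↑v) ∘ₗ (A.gr (-n)).subtype)) ∧
    (∀ (n : ℤ), ∀ v ∈ V.gm n, ∀ b : A.R, Ψ (V.D v) b = -(sgnz n) • Ψ v (A.d b)) ∧
    (∀ (i : ℤ) (x : A.R), x ∈ A.gr i → ∀ (n : ℤ), ∀ v ∈ V.gm n, ∀ b : A.R,
      Ψ (V.actL x v) b = sgnz (i * n) • Ψ v (b * x)) ∧
    ∀ (x : A.R) (v : V.M) (b : A.R), Ψ (V.actR x v) b = Ψ v (x * b)

/-- The degree-`n` part of the bimodule Hom complex `Hom_{Aᵉ}(P, T)`, for a target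
complex `T` equipped with (degreewise) commuting `Aᵉ`-actions `actLT`, `actRT`. -/
def bheGrade (P : DGBimod A) {T : Type} [AddCommGroup T] [Module k T]
    (gmT : ℤ → Submodule k T) (actLT actRT : ℤ → A.R → T →ₗ[k] T) (n : ℤ) :
    Submodule k (P.M →ₗ[k] T) where
  carrier := {g | (∀ (j : ℤ), ∀ m ∈ P.gm j, g m ∈ gmT (j + n)) ∧
    (∀ (i : ℤ) (x : A.R), x ∈ A.gr i → ∀ m : P.M,
      g (P.actL x m) = sgnz (i * n) • actLT i x (g m)) ∧
    ∀ (i : ℤ) (x : A.R), x ∈ A.gr i → ∀ m : P.M, g (P.actR x m) = actRT i x (g m)}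
  add_mem' := by
    rintro f g ⟨hf1, hf2, hf3⟩ ⟨hg1, hg2, hg3⟩
    exact ⟨fun j m hm => (gmT (j + n)).add_mem (hf1 j m hm) (hg1 j m hm),
      fun i x hx m => by simp [hf2 i x hx, hg2 i x hx, smul_add],
      fun i x hx m => by simp [hf3 i x hx, hg3 i x hx]⟩
  zero_mem' := ⟨fun j m hm => (gmT (j + n)).zero_mem,
    fun i x hx m => by simp, fun i x hx m => by simp⟩
  smul_mem' := by
    rintro c f ⟨hf1, hf2, hf3⟩
    refine ⟨fun j m hm => (gmT (j + n)).smul_mem c (hf1 j m hm), fun i x hx m => ?_,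
      fun i x hx m => by simp [hf3 i x hx]⟩
    simp only [LinearMap.smul_apply, hf2 i x hx, map_smul]
    rw [smul_comm]

/-- The differential of the bimodule Hom complex in degree `n`. -/
def bhDop (P : DGBimod A) {T : Type} [AddCommGroup T] [Module k T]
    (DT : T →ₗ[k] T) (n : ℤ) : (P.M →ₗ[k] T) →ₗ[k] (P.M →ₗ[k] T) :=
  (LinearMap.llcomp k P.M T T) DT - sgnz n • (LinearMap.llcomp k P.M P.M T).flip P.D

/-- Closed degree-`n` elements of the bimodule Hom complex. -/
def ZbhS (P : DGBimod A) {T : Type} [AddCommGroup T] [Module k T]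
    (gmT : ℤ → Submodule k T) (actLT actRT : ℤ → A.R → T →ₗ[k] T)
    (DT : T →ₗ[k] T) (n : ℤ) : Submodule k (P.M →ₗ[k] T) :=
  bheGrade P gmT actLT actRT n ⊓ LinearMap.ker (bhDop P DT n)

/-- Boundaries of degree `n` of the bimodule Hom complex. -/
def BbhS (P : DGBimod A) {T : Type} [AddCommGroup T] [Module k T]
    (gmT : ℤ → Submodule k T) (actLT actRT : ℤ → A.R → T →ₗ[k] T)
    (DT : T →ₗ[k] T) (n : ℤ) : Submodule k (P.M →ₗ[k] T) :=
  Submodule.map (bhDop P DT (n - 1)) (bheGrade P gmT actLT actRT (n - 1))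

/-- Cohomology of the bimodule Hom complex (`Ext` over `Aᵉ`). -/
def ExtBSpace (P : DGBimod A) {T : Type} [AddCommGroup T] [Module k T]
    (gmT : ℤ → Submodule k T) (actLT actRT : ℤ → A.R → T →ₗ[k] T)
    (DT : T →ₗ[k] T) (n : ℤ) : Type :=
  ↥(ZbhS P gmT actLT actRT DT n) ⧸
    (Submodule.comap (ZbhS P gmT actLT actRT DT n).subtype
      (BbhS P gmT actLT actRT DT n ⊓ ZbhS P gmT actLT actRT DT n))

instance (P : DGBimod A) {T : Type} [AddCommGroup T] [Module k T]
    (gmT : ℤ → Submodule k T) (actLT actRT : ℤ → A.R → T →ₗ[k] T)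
    (DT : T →ₗ[k] T) (n : ℤ) : AddCommGroup (ExtBSpace P gmT actLT actRT DT n) := by
  unfold ExtBSpace; infer_instance

instance (P : DGBimod A) {T : Type} [AddCommGroup T] [Module k T]
    (gmT : ℤ → Submodule k T) (actLT actRT : ℤ → A.R → T →ₗ[k] T)
    (DT : T →ₗ[k] T) (n : ℤ) : Module k (ExtBSpace P gmT actLT actRT DT n) := by
  unfold ExtBSpace; infer_instance

/-- The differential of `Aᵉ` on the underlying space `A.R ⊗[k] A.R`. -/
def aeD (A : DGAlgebra k) : (A.R ⊗[k] A.R) →ₗ[k] (A.R ⊗[k] A.R) :=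
  tenD A.d (gop A.gr fun j => sgnk k j) A.d

/-- The inner (module) action of a homogeneous element of degree `i` on the left slot
of the free `Aᵉ`-module `Aᵉ`. -/
def aeInnerL (A : DGAlgebra k) (i : ℤ) (x : A.R) : (A.R ⊗[k] A.R) →ₗ[k] (A.R ⊗[k] A.R) :=
  TensorProduct.map (LinearMap.mulLeft k x) (gop A.gr fun j => sgnk k (i * j))

/-- The inner (module) action on the right slot of the free `Aᵉ`-module `Aᵉ`. -/
def aeInnerR (A : DGAlgebra k) (i : ℤ) (x : A.R) : (A.R ⊗[k] A.R) →ₗ[k] (A.R ⊗[k] A.R) :=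
  TensorProduct.map LinearMap.id (LinearMap.mulRight k x)

/-- The outer left action on the free `Aᵉ`-module `Aᵉ`. -/
def aeOuterL (A : DGAlgebra k) (i : ℤ) (x : A.R) : (A.R ⊗[k] A.R) →ₗ[k] (A.R ⊗[k] A.R) :=
  TensorProduct.map (LinearMap.mulRight k x) LinearMap.id

/-- The outer right action on the free `Aᵉ`-module `Aᵉ`. -/
def aeOuterR (A : DGAlgebra k) (i : ℤ) (x : A.R) : (A.R ⊗[k] A.R) →ₗ[k] (A.R ⊗[k] A.R) :=
  TensorProduct.map (gop A.gr fun j => sgnk k (i * j)) (LinearMap.mulLeft k x)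

/-- `E` represents the inverse dualizing bimodule
`A^! = RHom_{(Aᵉ)ᵒᵖ}(A, (Aᵉ)ᵒᵖ)`: `E` is identified, via `Φ`, with the bimodule Hom
complex `Hom_{Aᵉ}(P, Aᵉ)` for an h-projective bimodule resolution `P` of the diagonal. -/
def RepresentsShriek {A : DGAlgebra k} (E : DGBimod A) : Prop :=
  ∃ (P : DGBimod A) (F : BimodHom P (diagBimod A)), IsDiagResolution P F ∧
  ∃ Φ : E.M →ₗ[k] (P.M →ₗ[k] (A.R ⊗[k] A.R)),
    Function.Injective Φ ∧
    (∀ n : ℤ, Submodule.map Φ (E.gm n) =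
      bheGrade P (tenGrade A.gr A.gr) (aeInnerL A) (aeInnerR A) n) ∧
    (∀ (n : ℤ), ∀ v ∈ E.gm n, Φ (E.D v) = bhDop P (aeD A) n (Φ v)) ∧
    (∀ (i : ℤ) (x : A.R), x ∈ A.gr i → ∀ v : E.M,
      Φ (E.actL x v) = aeOuterL A i x ∘ₗ Φ v) ∧
    ∀ (i : ℤ) (x : A.R), x ∈ A.gr i → ∀ v : E.M,
      Φ (E.actR x v) = aeOuterR A i x ∘ₗ Φ v

/-! ### Proof -/

theorem sgnz_sq (n : ℤ) : sgnz n * sgnz n = 1 := by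
  unfold sgnz; split_ifs <;> simp

theorem sgnz_pred (n : ℤ) : sgnz (n - 1) = - sgnz n := by
  unfold sgnz
  rcases Int.even_or_odd n with h | h
  · have : ¬ Even (n - 1) := by rw [Int.not_even_iff_odd]; exact h.sub_odd odd_one
    simp [h, this]
  · have h1 : Even (n - 1) := h.sub_odd odd_one
    have h2 : ¬ Even n := by rwa [Int.not_even_iff_odd]
    simp [h1, h2]

theorem sgnz_add (i j : ℤ) : sgnz (i + j) = sgnz i * sgnz j := by
  unfold sgnz
  simp only [Int.even_add]
  split_ifs <;> simp_all

theorem zs_mem {V : Type} [AddCommGroup V] [Module k V] (p : Submodule k V) {x : V}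
    (hx : x ∈ p) (n : ℤ) : n • x ∈ p := zsmul_mem hx n

/-- Finite total cohomology, elementary form. -/
def FC {V : Type} [AddCommGroup V] [Module k V] (G : ℤ → Submodule k V)
    (d : ℤ → V →ₗ[k] V) : Prop :=
  (∀ n, ∃ F : Submodule k V, F.FG ∧
    G n ⊓ LinearMap.ker (d n) ≤ F ⊔ (G (n - 1)).map (d (n - 1))) ∧
  {n | ¬ G n ⊓ LinearMap.ker (d n) ≤ (G (n - 1)).map (d (n - 1))}.Finite

theorem fg_lift {V W : Type} [AddCommGroup V] [Module k V] [AddCommGroup W] [Module k W]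
    (p : V →ₗ[k] W) (Z : Submodule k V) (F : Submodule k W) (hF : F.FG) :
    ∃ F0 : Submodule k V, F0.FG ∧ F0 ≤ Z ∧ F ⊓ Z.map p ≤ F0.map p := by
  have : Module.Finite k F := Module.Finite.iff_fg.mpr hF
  have h1 : (F ⊓ Z.map p).FG := by
    have : Module.Finite k (F ⊓ Z.map p : Submodule k W) :=
      Submodule.finiteDimensional_of_le (inf_le_left : _ ≤ F)
    exact Module.Finite.iff_fg.mp this
  obtain ⟨S, hS⟩ := h1
  have hsub : (S : Set W) ⊆ p '' Z := by
    intro x hx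
    have : x ∈ F ⊓ Z.map p := hS ▸ Submodule.subset_span hx
    exact this.2
  obtain ⟨t, ht, hfin, himg⟩ := Set.exists_subset_image_finite_and.mp
    ⟨(S : Set W), hsub, S.finite_toSet, rfl⟩
  refine ⟨Submodule.span k t, Submodule.fg_span hfin, Submodule.span_le.mpr ht, ?_⟩
  rw [Submodule.map_span, ← himg, hS]

theorem FC_ext {V W : Type} [AddCommGroup V] [Module k V] [AddCommGroup W] [Module k W]
    (G G' : ℤ → Submodule k V) (d : ℤ → V →ₗ[k] V) (H : ℤ → Submodule k W)
    (δ : ℤ → W →ₗ[k] W) (p : V →ₗ[k] W) (c : ℤ)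
    (h1 : ∀ n, ∀ z ∈ G n, p z ∈ H (n + c))
    (h2 : ∀ n, ∀ z ∈ G n, d n z = 0 → δ (n + c) (p z) = 0)
    (h3 : ∀ n, ∀ h ∈ H (n + c - 1), ∃ g ∈ G (n - 1), d (n - 1) g ∈ G n ∧
      p (d (n - 1) g) = δ (n + c - 1) h ∧ d n (d (n - 1) g) = 0)
    (h4 : ∀ n, ∀ z ∈ G n, p z = 0 → z ∈ G' n)
    (h5 : ∀ n, G' n ≤ G n)
    (hG' : FC G' d) (hH : FC H δ) : FC G d := by
  have key : ∀ n, ∀ F : Submodule k W, F.FG →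
      H (n + c) ⊓ LinearMap.ker (δ (n + c)) ≤ F ⊔ (H (n + c - 1)).map (δ (n + c - 1)) →
      ∀ z ∈ G n ⊓ LinearMap.ker (d n), ∃ b ∈ (G (n - 1)).map (d (n - 1)),
        z - b ∈ G n ⊓ LinearMap.ker (d n) ∧ p (z - b) ∈ F := by
    intro n F hF hle z hz
    have hpz : p z ∈ H (n + c) ⊓ LinearMap.ker (δ (n + c)) :=
      ⟨h1 n z hz.1, h2 n z hz.1 hz.2⟩
    obtain ⟨f, hf, b, ⟨h, hh, rfl⟩, hfb⟩ := Submodule.mem_sup.mp (hle hpz)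
    obtain ⟨g, hg, hg1, hg2, hg3⟩ := h3 n h hh
    refine ⟨d (n - 1) g, ⟨g, hg, rfl⟩, Submodule.sub_mem _ hz ⟨hg1, hg3⟩, ?_⟩
    rw [map_sub, hg2, ← hfb]
    simpa using hf
  constructor
  · intro n
    obtain ⟨F, hF, hle⟩ := hH.1 (n + c)
    obtain ⟨F', hF', hle'⟩ := hG'.1 n
    obtain ⟨F0, hF0, hF0Z, hF0p⟩ := fg_lift p (G n ⊓ LinearMap.ker (d n)) F hF
    refine ⟨F0 ⊔ F', hF0.sup hF', ?_⟩
    intro z hz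
    obtain ⟨b, hb, hzb, hpF⟩ := key n F hF hle z hz
    obtain ⟨z0, hz0, hz0p⟩ := hF0p ⟨hpF, ⟨_, hzb, rfl⟩⟩
    have hk : z - b - z0 ∈ G n ⊓ LinearMap.ker (d n) :=
      Submodule.sub_mem _ hzb (hF0Z hz0)
    have hk' : z - b - z0 ∈ G' n ⊓ LinearMap.ker (d n) :=
      ⟨h4 n _ hk.1 (by rw [map_sub, hz0p, sub_self]), hk.2⟩
    have h6 := hle' hk'
    have hB : (G' (n - 1)).map (d (n - 1)) ≤ (G (n - 1)).map (d (n - 1)) :=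
      Submodule.map_mono (h5 _)
    have e1 : z - b - z0 ∈ F0 ⊔ F' ⊔ (G (n - 1)).map (d (n - 1)) :=
      (sup_le_sup le_sup_right hB) h6
    have e2 : b ∈ F0 ⊔ F' ⊔ (G (n - 1)).map (d (n - 1)) := Submodule.mem_sup_right hb
    have e3 : z0 ∈ F0 ⊔ F' ⊔ (G (n - 1)).map (d (n - 1)) :=
      Submodule.mem_sup_left (Submodule.mem_sup_left hz0)
    have := Submodule.add_mem _ (Submodule.add_mem _ e1 e2) e3
    convert this using 1
    abel
  · refine ((hH.2.preimage (f := fun n => n + c)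
      (fun a _ b _ h => by simpa using h)).union hG'.2).subset ?_
    intro n hn
    by_contra hcon
    simp only [Set.mem_union, Set.mem_preimage, Set.mem_ofPred_eq, not_or, not_not] at hcon
    apply hn
    intro z hz
    obtain ⟨b, hb, hzb, hpF⟩ := key n ⊥ Submodule.fg_bot (by simpa using hcon.1) z hz
    have hk' : z - b ∈ G' n ⊓ LinearMap.ker (d n) :=
      ⟨h4 n _ hzb.1 (by simpa using hpF), hzb.2⟩
    have h6 := Submodule.map_mono (f := d (n - 1)) (h5 _) (hcon.2 hk')
    have := Submodule.add_mem _ h6 hb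
    simpa using this

theorem FC_retract {V W : Type} [AddCommGroup V] [Module k V] [AddCommGroup W] [Module k W]
    (G : ℤ → Submodule k V) (d : ℤ → V →ₗ[k] V) (H : ℤ → Submodule k W)
    (δ : ℤ → W →ₗ[k] W) (p : V →ₗ[k] W)
    (h1 : ∀ n, ∀ g ∈ G (n - 1), p (d (n - 1) g) ∈ (H (n - 1)).map (δ (n - 1)))
    (h2 : ∀ n, ∀ w ∈ H n, δ n w = 0 → ∃ v ∈ G n, d n v = 0 ∧
      w - p v ∈ (H (n - 1)).map (δ (n - 1)))
    (hG : FC G d) : FC H δ := by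
  have hB : ∀ n, ((G (n - 1)).map (d (n - 1))).map p ≤ (H (n - 1)).map (δ (n - 1)) := by
    rintro n _ ⟨_, ⟨g, hg, rfl⟩, rfl⟩
    exact h1 n g hg
  constructor
  · intro n
    obtain ⟨F, hF, hle⟩ := hG.1 n
    refine ⟨F.map p, hF.map p, ?_⟩
    rintro w ⟨hw1, hw2⟩
    obtain ⟨v, hv, hv0, hwv⟩ := h2 n w hw1 hw2
    have h3 : p v ∈ (F ⊔ (G (n - 1)).map (d (n - 1))).map p := ⟨v, hle ⟨hv, hv0⟩, rfl⟩
    rw [Submodule.map_sup] at h3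
    have h4 := sup_le_sup_left (hB n) (F.map p) h3
    have := Submodule.add_mem _ ((le_sup_right : _ ≤ F.map p ⊔ _) hwv) h4
    simpa using this
  · refine hG.2.subset ?_
    intro n hn hle
    apply hn
    rintro w ⟨hw1, hw2⟩
    obtain ⟨v, hv, hv0, hwv⟩ := h2 n w hw1 hw2
    have h3 := hB n ⟨v, hle ⟨hv, hv0⟩, rfl⟩
    have := Submodule.add_mem _ hwv h3
    simpa using this

theorem FC_of_quot {V : Type} [AddCommGroup V] [Module k V] (G : ℤ → Submodule k V)
    (d : ℤ → V →ₗ[k] V) (Z B : ℤ → Submodule k V)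
    (hZ : ∀ n, G n ⊓ LinearMap.ker (d n) = Z n)
    (hB : ∀ n, (B n) ≤ (G (n - 1)).map (d (n - 1)))
    (h1 : ∀ n, FiniteDimensional k (↥(Z n) ⧸ (B n).comap (Z n).subtype))
    (h2 : {n | ¬ Subsingleton (↥(Z n) ⧸ (B n).comap (Z n).subtype)}.Finite) : FC G d := by
  constructor
  · intro n
    have hfg : (⊤ : Submodule k (↥(Z n) ⧸ (B n).comap (Z n).subtype)).FG := (h1 n).fg_top
    obtain ⟨F0, hF0, -, hle⟩ := fg_lift ((B n).comap (Z n).subtype).mkQ ⊤ ⊤ hfg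
    refine ⟨F0.map (Z n).subtype, hF0.map _, ?_⟩
    rw [hZ]
    intro z hz
    have : ((B n).comap (Z n).subtype).mkQ ⟨z, hz⟩ ∈ F0.map ((B n).comap (Z n).subtype).mkQ :=
      hle ⟨trivial, ⟨_, trivial, rfl⟩⟩
    obtain ⟨f, hf, hfz⟩ := this
    have h5 : f - ⟨z, hz⟩ ∈ (B n).comap (Z n).subtype := (Submodule.Quotient.eq _).mp hfz
    have h6 : (f : V) - z ∈ B n := h5
    have h7 := Submodule.sub_mem _
      ((le_sup_left : _ ≤ F0.map (Z n).subtype ⊔ (G (n - 1)).map (d (n - 1)))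
        (Submodule.mem_map_of_mem (f := (Z n).subtype) hf))
      ((le_sup_right : _ ≤ F0.map (Z n).subtype ⊔ _) (hB n h6))
    simpa using h7
  · refine h2.subset ?_
    intro n hn hs
    apply hn
    rw [hZ]
    intro z hz
    rw [Submodule.Quotient.subsingleton_iff] at hs
    have : (⟨z, hz⟩ : Z n) ∈ (B n).comap (Z n).subtype := hs ▸ trivial
    exact hB n this

theorem quot_of_FC {V : Type} [AddCommGroup V] [Module k V] (G : ℤ → Submodule k V)
    (d : ℤ → V →ₗ[k] V) (Z B : ℤ → Submodule k V)
    (hZ : ∀ n, G n ⊓ LinearMap.ker (d n) = Z n)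
    (hB : ∀ n, (G (n - 1)).map (d (n - 1)) ⊓ Z n ≤ B n)
    (h : FC G d) :
    (∀ n, FiniteDimensional k (↥(Z n) ⧸ (B n).comap (Z n).subtype)) ∧
    {n | ¬ Subsingleton (↥(Z n) ⧸ (B n).comap (Z n).subtype)}.Finite := by
  constructor
  · intro n
    obtain ⟨F, hF, hle⟩ := h.1 n
    rw [hZ] at hle
    set C := (G (n - 1)).map (d (n - 1))
    let φ : ↥(Z n) →ₗ[k] (V ⧸ C) := C.mkQ ∘ₗ (Z n).subtype
    have hrange : LinearMap.range φ ≤ F.map C.mkQ := by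
      rintro _ ⟨z, rfl⟩
      obtain ⟨f, hf, b, hb, hfb⟩ := Submodule.mem_sup.mp (hle z.2)
      refine ⟨f, hf, ?_⟩
      change C.mkQ f = C.mkQ z
      rw [← hfb, map_add]
      have : C.mkQ b = 0 := (Submodule.Quotient.mk_eq_zero C).mpr hb
      rw [this, add_zero]
    have hFm : Module.Finite k (F.map C.mkQ) := Module.Finite.iff_fg.mpr (hF.map _)
    have hfin : FiniteDimensional k (LinearMap.range φ) := Submodule.finiteDimensional_of_le hrange
    have hfin2 : FiniteDimensional k (↥(Z n) ⧸ LinearMap.ker φ) :=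
      Module.Finite.equiv φ.quotKerEquivRange.symm
    have hk : LinearMap.ker φ ≤ (B n).comap (Z n).subtype := by
      intro z hz
      have : C.mkQ (z : V) = 0 := hz
      have : (z : V) ∈ C := (Submodule.Quotient.mk_eq_zero C).mp this
      exact hB n ⟨this, z.2⟩
    exact Module.Finite.of_surjective (Submodule.factor hk) (Submodule.factor_surjective hk)
  · refine h.2.subset ?_
    intro n hn hle
    apply hn
    rw [Submodule.Quotient.subsingleton_iff, eq_top_iff]
    intro z _
    rw [hZ] at hle
    exact hB n ⟨hle z.2, z.2⟩

theorem decompose_shift {M N : Type} [AddCommGroup M] [Module k M] [AddCommGroup N] [Module k N]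
    (gm : ℤ → Submodule k M) [DirectSum.Decomposition gm]
    (gn : ℤ → Submodule k N) [DirectSum.Decomposition gn] (φ : M →ₗ[k] N) (c : ℤ)
    (hφ : ∀ j, ∀ m ∈ gm j, φ m ∈ gn (j + c)) (x : M) (j l : ℤ) (hl : j + c = l) :
    (DirectSum.decompose gn (φ x) l : N) = φ (DirectSum.decompose gm x j) := by
  subst hl
  induction x using DirectSum.Decomposition.inductionOn gm with
  | zero => simp
  | @homogeneous i m =>
    by_cases hij : i = j
    · subst hij
      rw [DirectSum.decompose_of_mem_same _ (hφ _ _ m.2), DirectSum.decompose_of_mem_same _ m.2]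
    · rw [DirectSum.decompose_of_mem_ne _ (hφ _ _ m.2) (by simpa using hij),
        DirectSum.decompose_of_mem_ne _ m.2 hij, map_zero]
  | add a b ha hb => simp [ha, hb]

theorem FC_alg (A : DGAlgebra k) (hc : IsCompactAlg A) : FC A.gr (fun _ => A.d) := by
  refine FC_of_quot A.gr _ (Zg A.gr A.d) (Bg A.gr A.d) (fun n => rfl) ?_ hc.1 hc.2
  rintro n _ ⟨hy, y, rfl⟩
  refine ⟨DirectSum.decompose A.gr y (n - 1), SetLike.coe_mem _, ?_⟩
  rw [← decompose_shift A.gr A.gr A.d 1 A.d_deg y (n - 1) n (by ring),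
    DirectSum.decompose_of_mem_same _ hy]

theorem FC_summand (P T : DGMod A) (h : IsHoSummand P T) (hT : FC T.gm (fun _ => T.D)) :
    FC P.gm (fun _ => P.D) := by
  obtain ⟨ι, ρ, hh, hdeg, -, hhom⟩ := h
  refine FC_retract T.gm _ P.gm _ ρ.f ?_ ?_ hT
  · intro n g hg
    exact ⟨ρ.f g, ρ.deg _ _ hg, (ρ.comm g).symm⟩
  · intro n w hw hw0
    refine ⟨ι.f w, ι.deg _ _ hw, ?_, ?_⟩
    · rw [← ι.comm, hw0, map_zero]
    · refine ⟨- hh w, Submodule.neg_mem _ (hdeg _ _ hw), ?_⟩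
      have := hhom w
      rw [hw0, map_zero, add_zero] at this
      simp only [DGHom.comp, DGHom.id, LinearMap.comp_apply, LinearMap.id_apply] at this
      rw [map_neg, ← this]; abel

theorem homDop_apply (X Y : DGMod A) (n : ℤ) (f : X.M →ₗ[k] Y.M) (z : X.M) :
    homDop X Y n f z = Y.D (f z) - sgnz n • f (X.D z) := by
  simp [homDop]

theorem homDop_sq (X Y : DGMod A) (n : ℤ) (f : X.M →ₗ[k] Y.M) :
    homDop X Y n (homDop X Y (n - 1) f) = 0 := by
  ext z
  simp [homDop_apply, X.D_sq, Y.D_sq, sgnz_pred]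

theorem homDop_mem (X Y : DGMod A) (n : ℤ) (f : X.M →ₗ[k] Y.M)
    (hf : f ∈ homGrade X Y (n - 1)) : homDop X Y (n - 1) f ∈ homGrade X Y n := by
  obtain ⟨h1, h2⟩ := hf
  refine ⟨?_, ?_⟩
  · intro j m hm
    rw [homDop_apply]
    refine Submodule.sub_mem _ ?_ (zs_mem _ ?_ _)
    · have := Y.D_deg _ _ (h1 j m hm)
      rwa [show j + (n - 1) + 1 = j + n by ring] at this
    · have := h1 _ _ (X.D_deg j m hm)
      rwa [show j + 1 + (n - 1) = j + n by ring] at this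
  · intro x m
    induction x using DirectSum.Decomposition.inductionOn A.gr with
    | zero => simp
    | add a b ha hb => simp only [map_add, LinearMap.add_apply, ha, hb]
    | @homogeneous i x =>
      induction m using DirectSum.Decomposition.inductionOn X.gm with
      | zero => simp
      | add a b ha hb => simp only [map_add, ha, hb]
      | @homogeneous j m =>
        rw [homDop_apply, homDop_apply, h2, Y.leibniz i _ _ _ x.2 (h1 _ _ m.2),
          X.leibniz i j _ _ x.2 m.2, map_add, h2, map_zsmul, h2, sgnz_add, map_sub, map_zsmul,
          smul_add, smul_smul, mul_comm (sgnz j)]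
        abel

theorem FC_hom_summand (X T Y : DGMod A) (h : IsHoSummand X T)
    (hT : FC (homGrade T Y) (homDop T Y)) : FC (homGrade X Y) (homDop X Y) := by
  obtain ⟨ι, ρ, hh, hdeg, hact, hhom⟩ := h
  refine FC_retract _ _ _ _ (LinearMap.lcomp k Y.M ι.f) ?_ ?_ hT
  · intro n g hg
    refine ⟨g ∘ₗ ι.f, ⟨fun j m hm => hg.1 j _ (ι.deg j m hm), fun x m => ?_⟩, ?_⟩
    · simp [ι.actc, hg.2]
    · ext z
      simp [homDop_apply, ι.comm]
  · intro n w hw hw0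
    have hw1 : ∀ z, Y.D (w z) = sgnz n • w (X.D z) := by
      intro z
      have := congrArg (fun f => f z) hw0
      simp only [homDop_apply, LinearMap.zero_apply] at this
      exact sub_eq_zero.mp this
    refine ⟨w ∘ₗ ρ.f, ⟨fun j m hm => hw.1 j _ (ρ.deg j m hm), fun x m => ?_⟩, ?_, ?_⟩
    · simp [ρ.actc, hw.2]
    · ext z
      simp [homDop_apply, ρ.comm, hw1]
    · refine ⟨-(sgnz n • (w ∘ₗ hh)), Submodule.neg_mem _ (zs_mem (homGrade X Y (n - 1)) ⟨?_, ?_⟩ _), ?_⟩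
      · intro j m hm
        have := hw.1 _ _ (hdeg j m hm)
        rwa [show j - 1 + n = j + (n - 1) by ring] at this
      · intro x m
        simp [hact, hw.2]
      · ext z
        have h3 := congrArg w (hhom z)
        simp only [DGHom.comp, DGHom.id, LinearMap.comp_apply, LinearMap.id_apply, map_sub,
          map_add] at h3
        simp only [homDop_apply, LinearMap.neg_apply, LinearMap.smul_apply, LinearMap.comp_apply,
          LinearMap.sub_apply, LinearMap.lcomp_apply, map_neg, map_zsmul, hw1, sgnz_pred,
          neg_smul]
        rw [← neg_sub (w (ρ.f (ι.f z))), h3]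
        simp only [sub_neg_eq_add, smul_add, smul_smul, sgnz_sq, one_smul]

/-- Coordinates in a free basis. -/
theorem exists_coord (T : DGMod A) (s : ℕ) (r : Fin s → ℤ) (e : Fin s → T.M)
    (he : ∀ j, e j ∈ T.gm (-(r j)))
    (hb : Function.Bijective (fun v : Fin s → A.R => ∑ j, T.act (v j) (e j))) :
    ∃ q : Fin s → T.M →ₗ[k] A.R,
      (∀ z, ∑ j, T.act (q j z) (e j) = z) ∧
      (∀ j x z, q j (T.act x z) = q j z * x) ∧
      (∀ i j, q j (e i) = if i = j then 1 else 0) ∧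
      (∀ j n, ∀ z ∈ T.gm n, q j z ∈ A.gr (n + r j)) := by
  let Φ : (Fin s → A.R) →ₗ[k] T.M :=
    { toFun := fun v => ∑ j, T.act (v j) (e j)
      map_add' := by intro v w; simp [Finset.sum_add_distrib]
      map_smul' := by intro c v; simp [Finset.smul_sum] }
  have hΦ : Function.Bijective Φ := hb
  have hΦa : ∀ v, Φ v = ∑ j, T.act (v j) (e j) := fun _ => rfl
  let E := LinearEquiv.ofBijective Φ hΦ
  have hE : ∀ z, Φ (E.symm z) = z := fun z => E.apply_symm_apply z
  have hE2 : ∀ v z, Φ v = z → E.symm z = v := by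
    intro v z h
    apply hΦ.1
    rw [hE, h]
  refine ⟨fun j => (LinearMap.proj j) ∘ₗ E.symm.toLinearMap, ?_, ?_, ?_, ?_⟩
  · intro z; exact hE z
  · intro j x z
    change E.symm (T.act x z) j = E.symm z j * x
    rw [hE2 (fun j => E.symm z j * x)]
    rw [hΦa]
    conv_rhs => rw [← hE z, hΦa, map_sum]
    simp [T.act_mul]
  · intro i j
    change E.symm (e i) j = _
    rw [hE2 (fun j => if i = j then 1 else 0)]
    rw [hΦa, Finset.sum_eq_single i]
    · simp [T.act_one]
    · intro b _ hbi
      simp [hbi.symm]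
    · simp
  · intro j n z hz
    change E.symm z j ∈ _
    rw [hE2 (fun j => (DirectSum.decompose A.gr (E.symm z j) (n + r j) : A.R))]
    · exact SetLike.coe_mem _
    · rw [hΦa]
      rw [← DirectSum.decompose_of_mem_same T.gm hz]
      conv_rhs => rw [← hE z, hΦa]
      rw [DirectSum.decompose_sum, DFinsupp.finsetSum_apply, AddSubmonoidClass.coe_finsetSum]
      refine Finset.sum_congr rfl fun i _ => ?_
      rw [DirectSum.decompose_of_mem_same T.gm hz]
      exact (decompose_shift A.gr T.gm (T.act.flip (e i)) (-(r i))
        (fun l a ha => by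
          have := T.act_deg l _ a (e i) ha (he i)
          rwa [add_comm] at this) (E.symm z i) (n + r i) n (by ring)).symm

theorem FC_twisted (hc : IsCompactAlg A) (T : DGMod A) (hT : IsTwisted T) :
    FC T.gm (fun _ => T.D) := by
  obtain ⟨s, r, e, he, hD, hb⟩ := hT
  obtain ⟨q, q1, q2, q3, q4⟩ := exists_coord T s r e he hb
  let F : ℕ → Submodule k T.M := fun m => ⨅ j : {j : Fin s // m ≤ j.val}, LinearMap.ker (q j)
  have hF : ∀ m z, z ∈ F m ↔ ∀ j : Fin s, m ≤ j.val → q j z = 0 := by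
    intro m z
    simp [F]
  have hDF : ∀ j : Fin s, T.D (e j) ∈ F j.val := by
    intro j
    refine (sInf_le (a := F j.val) ⟨?_, ?_⟩ : rSpan T _ ≤ _) (hD j)
    · rintro _ ⟨i, hi, rfl⟩
      rw [SetLike.mem_coe, hF]
      intro l hl
      rw [q3, if_neg]
      rintro rfl
      exact absurd (show i.val < j.val from hi) (by omega)
    · intro x m hm
      rw [hF] at hm ⊢
      intro l hl
      rw [q2, hm l hl, zero_mul]
  -- differential of a homogeneous multiple of a basis element
  have hDact : ∀ (j : Fin s) (i : ℤ) (a : A.R), a ∈ A.gr i →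
      T.D (T.act a (e j)) = T.act a (T.D (e j)) + sgnz (-(r j)) • T.act (A.d a) (e j) :=
    fun j i a ha => T.leibniz i _ a _ ha (he j)
  have hq : ∀ (j l : Fin s) (i : ℤ) (a : A.R), a ∈ A.gr i → j.val ≤ l.val →
      q l (T.D (T.act a (e j))) = if j = l then sgnz (-(r l)) • A.d a else 0 := by
    intro j l i a ha hjl
    rw [hDact j i a ha, map_add, map_zsmul, q2, q2, q3, (hF _ _).mp (hDF j) l hjl]
    split_ifs with h
    · subst h; simp
    · simp
  have main : ∀ m, m ≤ s → FC (fun n => T.gm n ⊓ F m) (fun _ => T.D) := by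
    intro m
    induction m with
    | zero =>
      intro _
      have h0 : F 0 = ⊥ := by
        rw [eq_bot_iff]
        intro z hz
        rw [hF] at hz
        rw [Submodule.mem_bot, ← q1 z]
        exact Finset.sum_eq_zero fun j _ => by rw [hz j (Nat.zero_le _)]; simp
      refine ⟨fun n => ⟨⊥, Submodule.fg_bot, by simp [h0]⟩, ?_⟩
      convert Set.finite_empty
      simp [h0]
    | succ m ih =>
      intro hm
      let μ : Fin s := ⟨m, hm⟩
      have hqD : ∀ n, ∀ z ∈ T.gm n ⊓ F (m + 1), q μ (T.D z) = sgnz (-(r μ)) • A.d (q μ z) := by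
        rintro n z ⟨hz, hzF⟩
        rw [SetLike.mem_coe, hF] at hzF
        conv_lhs => rw [← q1 z]
        rw [map_sum, map_sum, Finset.sum_eq_single μ]
        · rw [hq μ μ _ _ (q4 μ n z hz) le_rfl, if_pos rfl]
        · intro j _ hj
          by_cases hjm : m + 1 ≤ j.val
          · rw [hzF j hjm]; simp
          · rw [hq j μ _ _ (q4 j n z hz) (by change j.val ≤ m; omega), if_neg hj]
        · simp
      refine FC_ext _ (fun n => T.gm n ⊓ F m) _ A.gr (fun _ => A.d) (q μ) (r μ)
        ?_ ?_ ?_ ?_ ?_ (ih (by omega)) (FC_alg A hc)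
      · intro n z hz; exact q4 μ n z hz.1
      · intro n z hz hz0
        have := hqD n z hz
        rw [hz0, map_zero] at this
        have h2 := congrArg (fun t => sgnz (-(r μ)) • t) this
        simp only [smul_smul, sgnz_sq, one_smul, smul_zero] at h2
        exact h2.symm
      · intro n h hh
        have hF1 : ∀ a, T.act a (e μ) ∈ F (m + 1) := by
          intro a
          rw [hF]
          intro j hj
          rw [q2, q3, if_neg, zero_mul]
          rintro rfl
          exact absurd hj (by change ¬ (m + 1 ≤ m); omega)
        have hg : T.act h (e μ) ∈ T.gm (n - 1) := by
          have := T.act_deg _ _ h (e μ) hh (he μ)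
          rwa [show -(r μ) + (n + r μ - 1) = n - 1 by ring] at this
        refine ⟨sgnz (-(r μ)) • T.act h (e μ), zs_mem (T.gm (n - 1) ⊓ F (m + 1)) ⟨hg, hF1 h⟩ _, ?_, ?_, ?_⟩
        · rw [map_zsmul]
          refine zs_mem (T.gm n ⊓ F (m + 1)) ⟨?_, ?_⟩ _
          · have := T.D_deg _ _ hg
            rwa [sub_add_cancel] at this
          · rw [hDact μ _ h hh]
            refine Submodule.add_mem _ ?_ (zs_mem _ (hF1 _) _)
            rw [hF]
            intro j hj
            rw [q2, (hF _ _).mp (hDF μ) j (by change m ≤ j.val; omega), zero_mul]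
        · rw [map_zsmul, map_zsmul, hq μ μ _ h hh le_rfl, if_pos rfl, smul_smul, sgnz_sq, one_smul]
        · exact T.D_sq _
      · rintro n z ⟨hz, hzF⟩ hz0
        refine ⟨hz, ?_⟩
        rw [SetLike.mem_coe, hF] at hzF ⊢
        intro j hj
        rcases hj.eq_or_lt with h | h
        · have : j = μ := Fin.ext h.symm
          rw [this, hz0]
        · exact hzF j h
      · rintro n z ⟨hz, hzF⟩
        refine ⟨hz, ?_⟩
        rw [SetLike.mem_coe, hF] at hzF ⊢
        exact fun j hj => hzF j (by omega)
  have hs : F s = ⊤ := by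
    rw [eq_top_iff]
    intro z _
    rw [hF]
    intro j hj
    exact absurd j.2 (by omega)
  have := main s le_rfl
  simpa only [hs, inf_top_eq] using this

/-- Maps in the Hom complex vanishing on the first `m` basis elements. -/
def homVan (T Y : DGMod A) {s : ℕ} (e : Fin s → T.M) (m : ℕ) (n : ℤ) :
    Submodule k (T.M →ₗ[k] Y.M) :=
  homGrade T Y n ⊓ ⨅ j : {j : Fin s // j.val < m}, LinearMap.ker (LinearMap.applyₗ (e j))

theorem mem_homVan (T Y : DGMod A) {s : ℕ} (e : Fin s → T.M) (m : ℕ) (n : ℤ)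
    (f : T.M →ₗ[k] Y.M) : f ∈ homVan T Y e m n ↔
      f ∈ homGrade T Y n ∧ ∀ j : Fin s, j.val < m → f (e j) = 0 := by
  simp [homVan]

theorem FC_hom_twisted (T Y : DGMod A) (hT : IsTwisted T) (hY : FC Y.gm (fun _ => Y.D)) :
    FC (homGrade T Y) (homDop T Y) := by
  obtain ⟨s, r, e, he, hD, hb⟩ := hT
  obtain ⟨q, q1, q2, q3, q4⟩ := exists_coord T s r e he hb
  have hvan : ∀ (j : Fin s) (n : ℤ) (m : ℕ), ∀ f ∈ homVan T Y e m n, j.val ≤ m →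
      f (T.D (e j)) = 0 := by
    intro j n m f hf hjm
    rw [mem_homVan] at hf
    refine (sInf_le (a := LinearMap.ker f) ⟨?_, ?_⟩ : rSpan T _ ≤ _) (hD j)
    · rintro _ ⟨i, hi, rfl⟩
      exact hf.2 i (lt_of_lt_of_le hi hjm)
    · intro x z hz
      rw [LinearMap.mem_ker] at hz ⊢
      rw [hf.1.2, hz, map_zero]
  have base : FC (homVan T Y e s) (homDop T Y) := by
    have h0 : ∀ n, homVan T Y e s n = ⊥ := by
      intro n
      rw [eq_bot_iff]
      intro f hf
      rw [mem_homVan] at hf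
      rw [Submodule.mem_bot]
      ext z
      rw [← q1 z, map_sum]
      refine Finset.sum_eq_zero fun j _ => ?_
      rw [hf.1.2, hf.2 j j.2, map_zero]
    refine ⟨fun n => ⟨⊥, Submodule.fg_bot, by simp [h0]⟩, ?_⟩
    convert Set.finite_empty
    simp [h0]
  have step : ∀ m, m < s → FC (homVan T Y e (m + 1)) (homDop T Y) →
      FC (homVan T Y e m) (homDop T Y) := by
    intro m hm ih
    let μ : Fin s := ⟨m, hm⟩
    refine FC_ext _ _ _ Y.gm (fun _ => Y.D) (LinearMap.applyₗ (e μ)) (-(r μ))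
      ?_ ?_ ?_ ?_ ?_ ih hY
    · intro n f hf
      have := ((mem_homVan ..).mp hf).1.1 _ _ (he μ)
      rwa [add_comm] at this
    · intro n f hf hf0
      have := congrArg (fun f => f (e μ)) hf0
      simp only [homDop_apply, hvan μ n m f hf le_rfl, smul_zero, sub_zero,
        LinearMap.zero_apply] at this
      exact this
    · intro n h hh
      let g : T.M →ₗ[k] Y.M := (Y.act.flip h) ∘ₗ q μ
      have hga : ∀ z, g z = Y.act (q μ z) h := fun _ => rfl
      have hg : g ∈ homVan T Y e m (n - 1) := by
        rw [mem_homVan]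
        refine ⟨⟨?_, ?_⟩, ?_⟩
        · intro j z hz
          have := Y.act_deg _ _ _ h (q4 μ j z hz) hh
          rwa [show n + -(r μ) - 1 + (j + r μ) = j + (n - 1) by ring] at this
        · intro x z
          rw [hga, hga, q2, Y.act_mul]
        · intro j hj
          rw [hga, q3, if_neg]
          · simp
          · rintro rfl
            exact absurd hj (by change ¬ (m < m); omega)
      refine ⟨g, hg, ?_, ?_, homDop_sq T Y n g⟩
      · rw [mem_homVan]
        refine ⟨homDop_mem T Y n g ((mem_homVan ..).mp hg).1, ?_⟩
        intro j hj
        rw [homDop_apply, hvan j _ m g hg hj.le, ((mem_homVan ..).mp hg).2 j hj]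
        simp
      · change homDop T Y (n - 1) g (e μ) = Y.D h
        rw [homDop_apply, hvan μ _ m g hg le_rfl, hga, q3, if_pos rfl, Y.act_one]
        simp
    · intro n f hf hf0
      rw [mem_homVan] at hf ⊢
      refine ⟨hf.1, fun j hj => ?_⟩
      rcases (Nat.lt_succ_iff.mp hj).eq_or_lt with h | h
      · have : j = μ := Fin.ext h
        rw [this]; exact hf0
      · exact hf.2 j h
    · intro n f hf
      rw [mem_homVan] at hf ⊢
      exact ⟨hf.1, fun j hj => hf.2 j (by omega)⟩
  have main : ∀ t, t ≤ s → FC (homVan T Y e (s - t)) (homDop T Y) := by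
    intro t
    induction t with
    | zero => intro _; exact base
    | succ t ih =>
      intro ht
      refine step _ (by omega) ?_
      rw [show s - (t + 1) + 1 = s - t by omega]
      exact ih (by omega)
  have h := main s le_rfl
  have h0 : homVan T Y e (s - s) = homGrade T Y := by
    funext n
    ext f
    rw [mem_homVan]
    simp
  rwa [h0] at h

/-- If `A` is a compact DG algebra over a field `k`, then the
category `Ho_per(A)` of perfect DG `A`-modules (homotopy direct summands of twisted
modules) is Ext-finite: for any objects `X`, `Y`, the total dimension
`∑ₙ dim Hom_{Ho(A)}(X, Y[n])` is finite. -/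
theorem perfect_ext_finite {k : Type} [Field k] (A : DGAlgebra k)
    (hc : IsCompactAlg A)
    (T X T' Y : DGMod A) (hT : IsTwisted T) (hX : IsHoSummand X T)
    (hT' : IsTwisted T') (hY : IsHoSummand Y T') :
    (∀ n : ℤ, FiniteDimensional k (ExtSpace X Y n)) ∧
      {n : ℤ | ¬ Subsingleton (ExtSpace X Y n)}.Finite := by
  have h1 := FC_summand Y T' hY (FC_twisted hc T' hT')
  have h2 := FC_hom_summand X T Y hX (FC_hom_twisted T Y hT h1)
  exact quot_of_FC (homGrade X Y) (homDop X Y) (ZHomS X Y)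
    (fun n => BHomS X Y n ⊓ ZHomS X Y n) (fun n => rfl) (fun n => le_rfl) h2
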